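/- (Proposition 3.2(i).) Assume there exist constants 0 < c ≤ C < ∞ such that g̃, ḡ, f̃, f̄ all take values in [c, C] and |μ̃_k| ≤ C, |μ̄_k| ≤ C for all k. Then there exist ρ ∈ (0,1) and C' < ∞, depending only on c, C, m and E, such that for all L, n ∈ ℕ with n ≥ L+1 and every bounded measurable φ^{(m)} : E^m → ℝ: | \tilde{π}^{(m)}_{1,n,n}(φ^{(m)}) − π^{(m)}_{(n)}(φ^{(m)}) | ≤ C' · ‖φ^{(m)}‖_∞ · ‖μ̄^{(m)}_{n-L} − π^{(m)}_{(n-L+1|n-L)}‖_TV · ρ^L, where ‖μ−ν‖_TV := sup_A |μ(A) − ν(A)| and μ̄^{(m)}_{n-L} denotes the probability measure on E^m with density proportional to μ^{(m)}_{n-L}. -/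

import Mathlib

open MeasureTheory
open scoped ENNReal NNReal

/-- Total variation distance `‖μ−ν‖_TV := sup_A |μ(A) − ν(A)|`, supremum over measurable sets. -/
noncomputable def tvDist {α : Type*} [MeasurableSpace α] (μ ν : Measure α) : ℝ :=
  ⨆ s : {s : Set α // MeasurableSet s}, |(μ s.1).toReal - (ν s.1).toReal|

/-- Normalization of the measure with density `ρ` with respect to `base`:
the "probability measure with density proportional to `ρ`". -/
noncomputable def normMeasure {α : Type*} [MeasurableSpace α] (base : Measure α) (ρ : α → ℝ) :
    Measure α :=
  (∫⁻ a, ENNReal.ofReal (ρ a) ∂base)⁻¹ • base.withDensity fun a => ENNReal.ofReal (ρ a)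

/-- Lebesgue measure on a subset `E ⊂ ℝ`, viewed as a measure on the subtype `↥E`. -/
noncomputable def subMeasure (E : Set ℝ) : Measure ↥E :=
  MeasureTheory.volume.comap Subtype.val

/-- The previous state `x_{i-1}` of a path (0-based), with the state before `x_1` being `x₀`. -/
def prevCoord {S : Type*} (x0 : S) {n : ℕ} (x : Fin n → S) (i : Fin n) : S :=
  if (i : ℕ) = 0 then x0 else x ⟨(i : ℕ) - 1, lt_of_le_of_lt (Nat.sub_le _ _) i.isLt⟩

/-- The unnormalized smoothing density `∏_{p=1}^n f(x_{p-1},x_p) g(x_p,y_p)`. -/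
noncomputable def smoothDensity {S Y : Type*} (f : S → S → ℝ) (g : S → Y → ℝ)
    (x0 : S) (y : ℕ → Y) (n : ℕ) (x : Fin n → S) : ℝ :=
  ∏ i : Fin n, (f (prevCoord x0 x i) (x i) * g (x i) (y ((i : ℕ) + 1)))

/-- The true filter `π_{(n)}`: the time-`n` marginal of the probability measure on `S^n`
with density proportional to `∏_{p=1}^n f(x_{p-1},x_p) g(x_p,y_p)`. -/
noncomputable def filterMarginal {S Y : Type*} [MeasurableSpace S] (base : Measure S)
    (f : S → S → ℝ) (g : S → Y → ℝ) (x0 : S) (y : ℕ → Y) (n : ℕ) (hn : 1 ≤ n) : Measure S :=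
  (normMeasure (Measure.pi fun _ : Fin n => base) (smoothDensity f g x0 y n)).map
    (fun x => x ⟨n - 1, by omega⟩)

/-- The predictive distribution `π_{(n-L+1|n-L)}`: the probability measure on `S` with density
`x' ↦ ∫ π_{(n-L)}(x) f(x,x') dx`. -/
noncomputable def predictiveMeasure {S Y : Type*} [MeasurableSpace S] (base : Measure S)
    (f : S → S → ℝ) (g : S → Y → ℝ) (x0 : S) (y : ℕ → Y) (k : ℕ) (hk : 1 ≤ k) : Measure S :=
  base.withDensity fun x' =>
    ENNReal.ofReal (∫ z, f z x' ∂(filterMarginal base f g x0 y k hk))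

/-- The density of the lagged block `(x_{n-L+1},…,x_n)`:
`μ_{n-L}(x_{n-L+1}) g(x_{n-L+1},y_{n-L+1}) ∏_{p=n-L+2}^{n} f(x_{p-1},x_p) g(x_p,y_p)`,
in block-local coordinates `Fin L → S` (index `t` corresponds to time `n-L+1+t`). -/
noncomputable def laggedBlockDensity {S Y : Type*} (f : S → S → ℝ) (g : S → Y → ℝ)
    (μ : ℕ → S → ℝ) (y : ℕ → Y) (L n : ℕ) (hL : 1 ≤ L) (x : Fin L → S) : ℝ :=
  μ (n - L) (x ⟨0, by omega⟩) * g (x ⟨0, by omega⟩) (y (n - L + 1)) *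
    ∏ t : Fin L,
      if 1 ≤ (t : ℕ) then
        f (x ⟨(t : ℕ) - 1, lt_of_le_of_lt (Nat.sub_le _ _) t.isLt⟩) (x t) *
          g (x t) (y (n - L + 1 + (t : ℕ)))
      else 1

/-- The lagged final-time marginal `π̃_{1,n,n}`: the time-`n` marginal of the probability
measure on `S^L`, in variables `(x_{n-L+1},…,x_n)`, with density proportional to the lagged
block density. -/
noncomputable def laggedFilterMarginal {S Y : Type*} [MeasurableSpace S] (base : Measure S)
    (f : S → S → ℝ) (g : S → Y → ℝ) (μ : ℕ → S → ℝ) (y : ℕ → Y) (L n : ℕ) (hL : 1 ≤ L) :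
    Measure S :=
  (normMeasure (Measure.pi fun _ : Fin L => base) (laggedBlockDensity f g μ y L n hL)).map
    (fun x => x ⟨L - 1, by omega⟩)

/-- The `m`-block likelihood `g^{(m)}(x^{1:m},y) = exp{ g̃(x^{1:m},y) + Σ_{j=1}^m ḡ(x^j,y) }`. -/
noncomputable def gBlock {E : Set ℝ} {Y : Type*} {m : ℕ} (gt : (Fin m → ↥E) → Y → ℝ)
    (gbar : ↥E → Y → ℝ) (x : Fin m → ↥E) (yy : Y) : ℝ :=
  Real.exp (gt x yy + ∑ j : Fin m, gbar (x j) yy)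

/-- The `m`-block transition density
`f^{(m)}(x^{1:m},z^{1:m}) = exp{ f̃(x^{1:m},z^{1:m}) + Σ_{j=1}^m f̄(x^j,z^j) }`. -/
noncomputable def fBlock {E : Set ℝ} {m : ℕ} (ft : (Fin m → ↥E) → (Fin m → ↥E) → ℝ)
    (fbar : ↥E → ↥E → ℝ) (x z : Fin m → ↥E) : ℝ :=
  Real.exp (ft x z + ∑ j : Fin m, fbar (x j) (z j))

/-- The `m`-block auxiliary density `μ^{(m)}_k(x^{1:m}) = exp{ μ̃_k(x^{1:m}) + Σ_{j=1}^m μ̄_k(x^j) }`. -/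
noncomputable def μBlock {E : Set ℝ} {m : ℕ} (μt : ℕ → (Fin m → ↥E) → ℝ)
    (μbar : ℕ → ↥E → ℝ) (k : ℕ) (x : Fin m → ↥E) : ℝ :=
  Real.exp (μt k x + ∑ j : Fin m, μbar k (x j))

/-- Bounded measurable real functions. -/
def IsBddMeasurable {S : Type*} [MeasurableSpace S] (ψ : S → ℝ) : Prop :=
  Measurable ψ ∧ ∃ K, ∀ x, |ψ x| ≤ K

namespace IsBddMeasurable

variable {S T : Type*} [MeasurableSpace S] [MeasurableSpace T] {φ ψ : S → ℝ}

lemma const (c : ℝ) : IsBddMeasurable fun _ : S => c :=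
  ⟨measurable_const, |c|, fun _ => le_rfl⟩

lemma of_mem_Icc {a b : ℝ} (hψ : Measurable ψ) (h : ∀ x, ψ x ∈ Set.Icc a b) :
    IsBddMeasurable ψ :=
  ⟨hψ, max |a| |b|, fun x => abs_le_max_abs_abs (h x).1 (h x).2⟩

lemma mul (hφ : IsBddMeasurable φ) (hψ : IsBddMeasurable ψ) :
    IsBddMeasurable fun x => φ x * ψ x := by
  obtain ⟨hφm, K, hK⟩ := hφ
  obtain ⟨hψm, K', hK'⟩ := hψ
  refine ⟨hφm.mul hψm, K * K', fun x => ?_⟩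
  rw [abs_mul]
  exact mul_le_mul (hK x) (hK' x) (abs_nonneg _) ((abs_nonneg _).trans (hK x))

lemma sub (hφ : IsBddMeasurable φ) (hψ : IsBddMeasurable ψ) :
    IsBddMeasurable fun x => φ x - ψ x := by
  obtain ⟨hφm, K, hK⟩ := hφ
  obtain ⟨hψm, K', hK'⟩ := hψ
  exact ⟨hφm.sub hψm, K + K', fun x => (abs_sub _ _).trans (add_le_add (hK x) (hK' x))⟩

lemma abs (hφ : IsBddMeasurable φ) : IsBddMeasurable fun x => |φ x| := by
  obtain ⟨hφm, K, hK⟩ := hφ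
  exact ⟨hφm.abs, K, fun x => by rw [abs_abs]; exact hK x⟩

lemma comp {θ : T → S} (hφ : IsBddMeasurable φ) (hθ : Measurable θ) :
    IsBddMeasurable fun x => φ (θ x) :=
  ⟨hφ.1.comp hθ, hφ.2.imp fun _ h x => h (θ x)⟩

lemma integrable (hφ : IsBddMeasurable φ) (ν : Measure S) [IsFiniteMeasure ν] :
    Integrable φ ν := by
  obtain ⟨hφm, K, hK⟩ := hφ
  exact Integrable.of_bound hφm.aestronglyMeasurable K (Filter.Eventually.of_forall hK)

lemma integral_right {F : S × T → ℝ} (hF : IsBddMeasurable F) (ν : Measure T)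
    [IsFiniteMeasure ν] : IsBddMeasurable fun x => ∫ z, F (x, z) ∂ν := by
  obtain ⟨hFm, K, hK⟩ := hF
  exact ⟨hFm.stronglyMeasurable.integral_prod_right'.measurable, K * ν.real Set.univ,
    fun x => norm_integral_le_of_norm_le_const (f := fun z => F (x, z))
      (Filter.Eventually.of_forall fun z => hK (x, z))⟩

end IsBddMeasurable

section Densities

variable {S : Type*} [MeasurableSpace S]

lemma normMeasure_eq_withDensity (ν : Measure S) [IsFiniteMeasure ν] {ρ : S → ℝ}
    (hρ : IsBddMeasurable ρ) (h0 : ∀ x, 0 ≤ ρ x) (hpos : 0 < ∫ x, ρ x ∂ν) :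
    normMeasure ν ρ = ν.withDensity fun x => ENNReal.ofReal (ρ x / ∫ z, ρ z ∂ν) := by
  unfold normMeasure
  rw [← ofReal_integral_eq_lintegral_ofReal (hρ.integrable ν) (Filter.Eventually.of_forall h0),
    ← ENNReal.ofReal_inv_of_pos hpos, ← withDensity_smul _ hρ.1.ennreal_ofReal]
  congr 1
  ext x
  rw [Pi.smul_apply, smul_eq_mul, ← ENNReal.ofReal_mul (inv_nonneg.2 hpos.le), div_eq_inv_mul]

lemma integral_withDensity_ofReal (ν : Measure S) {p : S → ℝ} (hp : Measurable p)
    (h0 : ∀ x, 0 ≤ p x) (φ : S → ℝ) :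
    ∫ x, φ x ∂(ν.withDensity fun x => ENNReal.ofReal (p x)) = ∫ x, p x * φ x ∂ν := by
  rw [integral_withDensity_eq_integral_toReal_smul hp.ennreal_ofReal
    (Filter.Eventually.of_forall fun _ => ENNReal.ofReal_lt_top)]
  simp [ENNReal.toReal_ofReal (h0 _)]

lemma integral_normMeasure (ν : Measure S) [IsFiniteMeasure ν] {ρ : S → ℝ}
    (hρ : IsBddMeasurable ρ) (h0 : ∀ x, 0 ≤ ρ x) (hpos : 0 < ∫ x, ρ x ∂ν) (φ : S → ℝ) :
    ∫ x, φ x ∂(normMeasure ν ρ) = (∫ x, ρ x * φ x ∂ν) / ∫ x, ρ x ∂ν := by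
  rw [normMeasure_eq_withDensity ν hρ h0 hpos, integral_withDensity_ofReal ν
    (hρ.1.div_const _) (fun x => div_nonneg (h0 x) hpos.le), ← integral_div]
  congr 1
  ext x
  ring

lemma isFiniteMeasure_normMeasure (ν : Measure S) [IsFiniteMeasure ν] {ρ : S → ℝ}
    (hρ : IsBddMeasurable ρ) (h0 : ∀ x, 0 ≤ ρ x) (hpos : 0 < ∫ x, ρ x ∂ν) :
    IsFiniteMeasure (normMeasure ν ρ) := by
  rw [normMeasure_eq_withDensity ν hρ h0 hpos]
  exact isFiniteMeasure_withDensity_ofReal ((hρ.integrable ν).div_const _).2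

lemma integral_abs_sub_le_two_mul_tvDist (ν : Measure S) [IsFiniteMeasure ν] {p q : S → ℝ}
    (hp : IsBddMeasurable p) (hq : IsBddMeasurable q) (hp0 : ∀ x, 0 ≤ p x)
    (hq0 : ∀ x, 0 ≤ q x) :
    ∫ x, |p x - q x| ∂ν ≤ 2 * tvDist (ν.withDensity fun x => ENNReal.ofReal (p x))
      (ν.withDensity fun x => ENNReal.ofReal (q x)) := by
  have key : ∀ r : S → ℝ, IsBddMeasurable r → (∀ x, 0 ≤ r x) → ∀ s, MeasurableSet s →
      (ν.withDensity (fun x => ENNReal.ofReal (r x)) s).toReal = ∫ x in s, r x ∂ν := by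
    intro r hr hr0 s hs
    rw [withDensity_apply _ hs, integral_eq_lintegral_of_nonneg_ae
      (Filter.Eventually.of_forall hr0) hr.1.aestronglyMeasurable]
  have hle : ∀ s, MeasurableSet s → |∫ x in s, (p x - q x) ∂ν| ≤
      tvDist (ν.withDensity fun x => ENNReal.ofReal (p x))
        (ν.withDensity fun x => ENNReal.ofReal (q x)) := by
    intro s hs
    have hbdd : BddAbove (Set.range fun s : {s : Set S // MeasurableSet s} =>
        |(ν.withDensity (fun x => ENNReal.ofReal (p x)) s.1).toReal
          - (ν.withDensity (fun x => ENNReal.ofReal (q x)) s.1).toReal|) := by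
      refine ⟨∫ x, |p x - q x| ∂ν, ?_⟩
      rintro _ ⟨t, rfl⟩
      dsimp only
      rw [key p hp hp0 t.1 t.2, key q hq hq0 t.1 t.2,
        ← integral_sub (hp.integrable _) (hq.integrable _)]
      exact abs_integral_le_integral_abs.trans (setIntegral_le_integral
        ((hp.sub hq).abs.integrable ν) (Filter.Eventually.of_forall fun _ => abs_nonneg _))
    have := le_ciSup hbdd ⟨s, hs⟩
    dsimp only at this
    rwa [key p hp hp0 s hs, key q hq hq0 s hs,
      ← integral_sub (hp.integrable _) (hq.integrable _)] at this
  have hs : MeasurableSet {x | q x ≤ p x} := measurableSet_le hq.1 hp.1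
  rw [← integral_add_compl hs ((hp.sub hq).abs.integrable ν), two_mul]
  refine add_le_add ?_ ?_
  · rw [setIntegral_congr_fun hs (g := fun x => p x - q x)
      fun x hx => abs_of_nonneg (sub_nonneg.2 hx)]
    exact (le_abs_self _).trans (hle _ hs)
  · rw [setIntegral_congr_fun hs.compl (g := fun x => -(p x - q x))
      fun x hx => abs_of_nonpos (sub_nonpos.2 (le_of_not_ge hx)), integral_neg]
    exact (neg_le_abs _).trans (hle _ hs.compl)

end Densities

section Propagation

variable {S : Type*} [MeasurableSpace S]

/-- The backward operator `ψ ↦ ∫ f(·,z) w(z) ψ(z) dz`. -/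
noncomputable def backwardStep (ν : Measure S) (f : S → S → ℝ) (w ψ : S → ℝ) (x : S) : ℝ :=
  ∫ z, f x z * (w z * ψ z) ∂ν

/-- The composition of `l` backward operators with successive weights `w 0, …, w (l - 1)`. -/
noncomputable def backward (ν : Measure S) (f : S → S → ℝ) :
    ℕ → (ℕ → S → ℝ) → (S → ℝ) → S → ℝ
  | 0, _, ψ => ψ
  | l + 1, w, ψ => backwardStep ν f (w 0) (backward ν f l (fun i => w (i + 1)) ψ)

variable {ν : Measure S} [IsFiniteMeasure ν] {f : S → S → ℝ}

lemma IsBddMeasurable.backwardStep (hf : IsBddMeasurable (Function.uncurry f)) {w ψ : S → ℝ}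
    (hw : IsBddMeasurable w) (hψ : IsBddMeasurable ψ) :
    IsBddMeasurable (backwardStep ν f w ψ) :=
  (hf.mul ((hw.mul hψ).comp measurable_snd)).integral_right ν

lemma IsBddMeasurable.backward (hf : IsBddMeasurable (Function.uncurry f)) :
    ∀ (l : ℕ) {w : ℕ → S → ℝ} {ψ : S → ℝ}, (∀ i, IsBddMeasurable (w i)) →
      IsBddMeasurable ψ → IsBddMeasurable (backward ν f l w ψ)
  | 0, _, _, _, hψ => hψ
  | l + 1, _, _, hw, hψ =>
    IsBddMeasurable.backwardStep hf (hw 0) (IsBddMeasurable.backward hf l (fun i => hw (i + 1)) hψ)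

lemma backwardStep_mem_Icc {a b : ℝ} (hfm : IsBddMeasurable (Function.uncurry f))
    (hf : ∀ x z, f x z ∈ Set.Icc a b) {w ψ : S → ℝ} (hw : IsBddMeasurable w)
    (hψ : IsBddMeasurable ψ) (h0 : ∀ z, 0 ≤ w z * ψ z) (x : S) :
    backwardStep ν f w ψ x ∈ Set.Icc (a * ∫ z, w z * ψ z ∂ν) (b * ∫ z, w z * ψ z ∂ν) := by
  have h1 := hw.mul hψ
  have h2 := (hfm.comp (θ := fun z => (x, z)) (by fun_prop)).mul h1
  unfold backwardStep
  rw [← integral_const_mul, ← integral_const_mul]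
  exact ⟨integral_mono ((h1.integrable ν).const_mul a) (h2.integrable ν)
      fun z => mul_le_mul_of_nonneg_right (hf x z).1 (h0 z),
    integral_mono (h2.integrable ν) ((h1.integrable ν).const_mul b)
      fun z => mul_le_mul_of_nonneg_right (hf x z).2 (h0 z)⟩

lemma backwardStep_sub_const_mul (hfm : IsBddMeasurable (Function.uncurry f))
    {w u v : S → ℝ} (hw : IsBddMeasurable w) (hu : IsBddMeasurable u)
    (hv : IsBddMeasurable v) (r : ℝ) (x : S) :
    backwardStep ν f w (fun z => v z - r * u z) x
      = backwardStep ν f w v x - r * backwardStep ν f w u x := by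
  have h := hfm.comp (θ := fun z => (x, z)) (by fun_prop)
  have hv' : Integrable (fun z => f x z * (w z * v z)) ν := (h.mul (hw.mul hv)).integrable ν
  have hu' : Integrable (fun z => f x z * (w z * u z)) ν := (h.mul (hw.mul hu)).integrable ν
  unfold backwardStep
  rw [← integral_const_mul, ← integral_sub hv' (hu'.const_mul r)]
  congr 1
  ext z
  ring

/-- One backward step contracts the range of a ratio `v / u` by the factor `1 - ε`. -/
lemma backwardStep_ratio_contract {a b ε : ℝ} (hε0 : 0 ≤ ε) (hε : ε * b ≤ a)
    (hfm : IsBddMeasurable (Function.uncurry f))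
    (hf : ∀ x z, f x z ∈ Set.Icc a b) {w u v : S → ℝ} (hw : IsBddMeasurable w)
    (hw0 : ∀ z, 0 < w z) (hu : IsBddMeasurable u) (hu0 : ∀ z, 0 < u z)
    (hv : IsBddMeasurable v) {lo hi : ℝ} (hI : 0 < ∫ z, w z * u z ∂ν)
    (hlo : ∀ x, lo * u x ≤ v x) (hhi : ∀ x, v x ≤ hi * u x) :
    ∃ lo' hi', hi' - lo' = (1 - ε) * (hi - lo) ∧
      (∀ x, lo' * backwardStep ν f w u x ≤ backwardStep ν f w v x) ∧
      ∀ x, backwardStep ν f w v x ≤ hi' * backwardStep ν f w u x := by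
  set N := ∫ z, w z * u z ∂ν with hN
  set V := ∫ z, w z * v z ∂ν with hV
  have hsub : ∀ r, ∫ z, w z * (v z - r * u z) ∂ν = V - r * N := by
    intro r
    rw [hN, hV, ← integral_const_mul, ← integral_sub ((hw.mul hv).integrable ν)
      (((hw.mul hu).integrable ν).const_mul r)]
    congr 1
    ext z
    ring
  have hbu : ∀ x, backwardStep ν f w u x ≤ b * N := fun x =>
    (backwardStep_mem_Icc hfm hf hw hu (fun z => (mul_pos (hw0 z) (hu0 z)).le) x).2
  have hVN : V = V / N * N := (div_mul_cancel₀ V hI.ne').symm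
  have hV1 : lo * N ≤ V := by
    have : 0 ≤ V - lo * N := by
      rw [← hsub]
      exact integral_nonneg fun z => mul_nonneg (hw0 z).le (sub_nonneg.2 (hlo z))
    linarith
  have hV2 : V ≤ hi * N := by
    have : V - hi * N ≤ 0 := by
      rw [← hsub]
      exact integral_nonpos fun z =>
        mul_nonpos_of_nonneg_of_nonpos (hw0 z).le (sub_nonpos.2 (hhi z))
    linarith
  have h1 : lo ≤ V / N := (le_div_iff₀ hI).2 hV1
  have h2 : V / N ≤ hi := (div_le_iff₀ hI).2 hV2
  refine ⟨lo + ε * (V / N - lo), hi - ε * (hi - V / N), by ring, fun x => ?_, fun x => ?_⟩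
  · have h3 := (backwardStep_mem_Icc (ν := ν) hfm hf hw (hv.sub ((IsBddMeasurable.const lo).mul hu))
      (fun z => mul_nonneg (hw0 z).le (sub_nonneg.2 (hlo z))) x).1
    rw [backwardStep_sub_const_mul hfm hw hu hv, hsub] at h3
    have h4 : ε * (V / N - lo) * backwardStep ν f w u x ≤ ε * (V / N - lo) * (b * N) :=
      mul_le_mul_of_nonneg_left (hbu x) (mul_nonneg hε0 (sub_nonneg.2 h1))
    have h5 : ε * (V / N - lo) * (b * N) = ε * b * (V - lo * N) := by
      field_simp
    have h6 : ε * b * (V - lo * N) ≤ a * (V - lo * N) :=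
      mul_le_mul_of_nonneg_right hε (sub_nonneg.2 hV1)
    linarith
  · have h3 := (backwardStep_mem_Icc (ν := ν) hfm hf hw
      (((IsBddMeasurable.const hi).mul hu).sub hv)
      (fun z => mul_nonneg (hw0 z).le (sub_nonneg.2 (hhi z))) x).1
    have h7 : backwardStep ν f w (fun z => hi * u z - v z) x
        = hi * backwardStep ν f w u x - backwardStep ν f w v x := by
      have := backwardStep_sub_const_mul (ν := ν) hfm hw hu hv hi x
      rw [← neg_sub, ← this]
      unfold backwardStep
      rw [← integral_neg]
      congr 1
      ext z
      ring
    have h8 : ∫ z, w z * (hi * u z - v z) ∂ν = hi * N - V := by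
      rw [← neg_sub, ← hsub, ← integral_neg]
      congr 1
      ext z
      ring
    rw [h7, h8] at h3
    have h4 : ε * (hi - V / N) * backwardStep ν f w u x ≤ ε * (hi - V / N) * (b * N) :=
      mul_le_mul_of_nonneg_left (hbu x) (mul_nonneg hε0 (sub_nonneg.2 h2))
    have h5 : ε * (hi - V / N) * (b * N) = ε * b * (hi * N - V) := by
      field_simp
    have h6 : ε * b * (hi * N - V) ≤ a * (hi * N - V) :=
      mul_le_mul_of_nonneg_right hε (sub_nonneg.2 hV2)
    linarith

lemma integral_pos_of_pos [NeZero ν] {ψ : S → ℝ} (hψ : IsBddMeasurable ψ) (h : ∀ x, 0 < ψ x) :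
    0 < ∫ x, ψ x ∂ν := by
  rw [integral_pos_iff_support_of_nonneg (fun x => (h x).le) (hψ.integrable ν)]
  have : Function.support ψ = Set.univ := Set.eq_univ_of_forall fun x => (h x).ne'
  rw [this]
  exact (NeZero.ne (ν Set.univ)).bot_lt

lemma exists_backward_one_mem_Icc [NeZero ν] {a b : ℝ} (ha : 0 < a) (hab : a ≤ b)
    (hfm : IsBddMeasurable (Function.uncurry f)) (hf : ∀ x z, f x z ∈ Set.Icc a b) :
    ∀ (l : ℕ) {w : ℕ → S → ℝ}, (∀ i, IsBddMeasurable (w i)) → (∀ i z, 0 < w i z) →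
      ∃ t, 0 < t ∧ ∀ x, backward ν f l w (fun _ => 1) x ∈ Set.Icc (a * t) (b * t)
  | 0, _, _, _ => by
    have hb := ha.trans_le hab
    refine ⟨b⁻¹, inv_pos.2 hb, fun x => ?_⟩
    rw [← div_eq_mul_inv, ← div_eq_mul_inv, div_self hb.ne']
    exact ⟨(div_le_one hb).2 hab, le_rfl⟩
  | l + 1, w, hw, hw0 => by
    obtain ⟨t, ht, h⟩ := exists_backward_one_mem_Icc ha hab hfm hf l
      (fun i => hw (i + 1)) (fun i => hw0 (i + 1))
    have hu := IsBddMeasurable.backward (ν := ν) hfm l (fun i => hw (i + 1))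
      (IsBddMeasurable.const 1)
    have h0 : ∀ z, 0 < w 0 z * backward ν f l (fun i => w (i + 1)) (fun _ => 1) z :=
      fun z => mul_pos (hw0 0 z) ((mul_pos ha ht).trans_le (h z).1)
    exact ⟨_, integral_pos_of_pos ((hw 0).mul hu) h0,
      backwardStep_mem_Icc hfm hf (hw 0) hu fun z => (h0 z).le⟩

lemma exists_backward_ratio_bounds [NeZero ν] {a b ε M : ℝ} (ha : 0 < a) (hab : a ≤ b)
    (hε0 : 0 ≤ ε) (hε : ε * b ≤ a) (hfm : IsBddMeasurable (Function.uncurry f))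
    (hf : ∀ x z, f x z ∈ Set.Icc a b) {φ : S → ℝ} (hφ : Measurable φ) (hφM : ∀ x, |φ x| ≤ M) :
    ∀ (l : ℕ) {w : ℕ → S → ℝ}, (∀ i, IsBddMeasurable (w i)) → (∀ i z, 0 < w i z) →
      ∃ lo hi, hi - lo = (1 - ε) ^ l * (2 * M) ∧
        (∀ x, lo * backward ν f l w (fun _ => 1) x ≤ backward ν f l w φ x) ∧
        ∀ x, backward ν f l w φ x ≤ hi * backward ν f l w (fun _ => 1) x
  | 0, _, _, _ => ⟨-M, M, by ring, fun x => by simpa [backward] using (abs_le.1 (hφM x)).1,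
      fun x => by simpa [backward] using (abs_le.1 (hφM x)).2⟩
  | l + 1, w, hw, hw0 => by
    obtain ⟨lo, hi, h, hlo, hhi⟩ := exists_backward_ratio_bounds ha hab hε0 hε hfm hf hφ hφM l
      (fun i => hw (i + 1)) (fun i => hw0 (i + 1))
    obtain ⟨t, ht, hu0⟩ := exists_backward_one_mem_Icc (ν := ν) ha hab hfm hf l
      (fun i => hw (i + 1)) (fun i => hw0 (i + 1))
    have hu := IsBddMeasurable.backward (ν := ν) hfm l (fun i => hw (i + 1))
      (IsBddMeasurable.const 1)
    have hv := IsBddMeasurable.backward (ν := ν) hfm l (fun i => hw (i + 1)) ⟨hφ, M, hφM⟩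
    have hu0' : ∀ z, 0 < backward ν f l (fun i => w (i + 1)) (fun _ => 1) z :=
      fun z => (mul_pos ha ht).trans_le (hu0 z).1
    obtain ⟨lo', hi', h', hlo', hhi'⟩ := backwardStep_ratio_contract (ν := ν) hε0 hε hfm hf
      (hw 0) (hw0 0) hu hu0' hv (integral_pos_of_pos ((hw 0).mul hu) fun z => mul_pos (hw0 0 z) (hu0' z)) hlo hhi
    exact ⟨lo', hi', by rw [h', h]; ring, hlo', hhi'⟩

/-- Stability of ratios of integrals with respect to the reweighting density. -/
lemma abs_integral_ratio_sub_le {p₁ p₂ q v : S → ℝ} (hp₁ : IsBddMeasurable p₁)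
    (hp₂ : IsBddMeasurable p₂) (hq : IsBddMeasurable q) (hv : IsBddMeasurable v)
    (hp₁0 : ∀ x, 0 ≤ p₁ x) (hp₂0 : ∀ x, 0 ≤ p₂ x) (hp₁1 : ∫ x, p₁ x ∂ν = 1)
    {α κ lo hi : ℝ} (hα : 0 < α) (hκ : 0 ≤ κ) (hlh : lo ≤ hi)
    (hqb : ∀ x, q x ∈ Set.Icc α (κ * α)) (hlo : ∀ x, lo * q x ≤ v x)
    (hhi : ∀ x, v x ≤ hi * q x) (hB₂ : 0 < ∫ x, p₂ x * q x ∂ν) :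
    |(∫ x, p₁ x * v x ∂ν) / (∫ x, p₁ x * q x ∂ν) - (∫ x, p₂ x * v x ∂ν) / ∫ x, p₂ x * q x ∂ν|
      ≤ 2 * κ * (hi - lo) * ∫ x, |p₁ x - p₂ x| ∂ν := by
  set D := ∫ x, |p₁ x - p₂ x| ∂ν with hD
  set B₁ := ∫ x, p₁ x * q x ∂ν with hB₁
  set B₂ := ∫ x, p₂ x * q x ∂ν
  have hD0 : 0 ≤ D := integral_nonneg fun _ => abs_nonneg _
  have hq0 : ∀ x, 0 ≤ q x := fun x => hα.le.trans (hqb x).1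
  have hα₁ : α ≤ B₁ := by
    have := integral_mono ((hp₁.integrable ν).mul_const α) ((hp₁.mul hq).integrable ν)
      fun x => mul_le_mul_of_nonneg_left (hqb x).1 (hp₁0 x)
    rwa [integral_mul_const, hp₁1, one_mul] at this
  have hB₁0 : 0 < B₁ := hα.trans_le hα₁
  have he : IsBddMeasurable fun x => v x - lo * q x := hv.sub ((IsBddMeasurable.const lo).mul hq)
  have hsplit : ∀ p, IsBddMeasurable p →
      ∫ x, p x * (v x - lo * q x) ∂ν = (∫ x, p x * v x ∂ν) - lo * ∫ x, p x * q x ∂ν := by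
    intro p hp
    rw [← integral_const_mul, ← integral_sub ((hp.mul hv).integrable ν)
      (((hp.mul hq).integrable ν).const_mul lo)]
    congr 1
    ext x
    ring
  have hdiff : ∀ (r : S → ℝ) (R : ℝ), IsBddMeasurable r → (∀ x, 0 ≤ r x) → (∀ x, r x ≤ R) →
      |(∫ x, p₁ x * r x ∂ν) - ∫ x, p₂ x * r x ∂ν| ≤ D * R := by
    intro r R hr hr0 hrR
    rw [← integral_sub ((hp₁.mul hr).integrable ν) ((hp₂.mul hr).integrable ν), hD,
      ← integral_mul_const]
    refine abs_integral_le_integral_abs.trans (integral_mono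
      (((hp₁.mul hr).sub (hp₂.mul hr)).abs.integrable ν)
      (((hp₁.sub hp₂).abs.integrable ν).mul_const R) fun x => ?_)
    dsimp only
    rw [← sub_mul, abs_mul, abs_of_nonneg (hr0 x)]
    exact mul_le_mul_of_nonneg_left (hrR x) (abs_nonneg _)
  set A₁ := ∫ x, p₁ x * (v x - lo * q x) ∂ν with hA₁
  set A₂ := ∫ x, p₂ x * (v x - lo * q x) ∂ν with hA₂
  have hA₂0 : 0 ≤ A₂ := integral_nonneg fun x => mul_nonneg (hp₂0 x) (sub_nonneg.2 (hlo x))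
  have hA₂B : A₂ ≤ (hi - lo) * B₂ := by
    rw [← integral_const_mul]
    refine integral_mono ((hp₂.mul he).integrable ν) (((hp₂.mul hq).integrable ν).const_mul _)
      fun x => ?_
    have := mul_le_mul_of_nonneg_left (hhi x) (hp₂0 x)
    dsimp only
    linarith
  have hA := hdiff _ ((hi - lo) * (κ * α)) he (fun x => sub_nonneg.2 (hlo x)) fun x => by
    have := mul_le_mul_of_nonneg_left (hqb x).2 (sub_nonneg.2 hlh)
    linarith [hhi x]
  have hB := hdiff q (κ * α) hq hq0 fun x => (hqb x).2
  have hid : (∫ x, p₁ x * v x ∂ν) / B₁ - (∫ x, p₂ x * v x ∂ν) / B₂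
      = ((A₁ - A₂) - A₂ / B₂ * (B₁ - B₂)) / B₁ := by
    have e₁ : ∫ x, p₁ x * v x ∂ν = A₁ + lo * B₁ := by rw [hA₁, hsplit p₁ hp₁]; ring
    have e₂ : ∫ x, p₂ x * v x ∂ν = A₂ + lo * B₂ := by rw [hA₂, hsplit p₂ hp₂]; ring
    rw [e₁, e₂]
    field_simp
    ring
  have hr : |A₂ / B₂| ≤ hi - lo := by
    rw [abs_of_nonneg (div_nonneg hA₂0 hB₂.le)]
    exact (div_le_iff₀ hB₂).2 hA₂B
  rw [hid, abs_div, abs_of_pos hB₁0, div_le_iff₀ hB₁0]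
  have h1 : |A₂ / B₂ * (B₁ - B₂)| ≤ (hi - lo) * (D * (κ * α)) := by
    rw [abs_mul]
    exact mul_le_mul hr hB (abs_nonneg _) (sub_nonneg.2 hlh)
  have h2 : 2 * κ * (hi - lo) * D * α ≤ 2 * κ * (hi - lo) * D * B₁ :=
    mul_le_mul_of_nonneg_left hα₁
      (mul_nonneg (mul_nonneg (by linarith) (sub_nonneg.2 hlh)) hD0)
  calc |(A₁ - A₂) - A₂ / B₂ * (B₁ - B₂)| ≤ |A₁ - A₂| + |A₂ / B₂ * (B₁ - B₂)| := abs_sub _ _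
    _ ≤ D * ((hi - lo) * (κ * α)) + (hi - lo) * (D * (κ * α)) := add_le_add hA h1
    _ = 2 * κ * (hi - lo) * D * α := by ring
    _ ≤ _ := h2

end Propagation

section Paths

variable {S : Type*}

/-- The path weight `h(x₀) ∏_{i<n} f(x_i, x_{i+1}) w_i(x_{i+1})`. -/
noncomputable def pathWeight (f : S → S → ℝ) (w : ℕ → S → ℝ) (h : S → ℝ) :
    ∀ n : ℕ, (Fin (n + 1) → S) → ℝ
  | 0, x => h (x 0)
  | n + 1, x => pathWeight f w h n (fun i => x i.castSucc) *
      (f (x (Fin.last n).castSucc) (x (Fin.last (n + 1))) * w n (x (Fin.last (n + 1))))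

lemma pathWeight_pos {f : S → S → ℝ} {w : ℕ → S → ℝ} {h : S → ℝ}
    (hf : ∀ x z, 0 < f x z) (hw : ∀ i z, 0 < w i z) (hh : ∀ x, 0 < h x) :
    ∀ n x, 0 < pathWeight f w h n x
  | 0, _ => hh _
  | n + 1, _ => mul_pos (pathWeight_pos hf hw hh n _) (mul_pos (hf _ _) (hw _ _))

lemma smoothDensity_succ {Y : Type*} (f : S → S → ℝ) (g : S → Y → ℝ) (x0 : S) (y : ℕ → Y) :
    ∀ n, smoothDensity f g x0 y (n + 1)
      = pathWeight f (fun i z => g z (y (i + 2))) (fun z => f x0 z * g z (y 1)) n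
  | 0 => by
    ext x
    simp [smoothDensity, pathWeight, prevCoord]
  | n + 1 => by
    ext x
    rw [pathWeight, ← smoothDensity_succ f g x0 y n, smoothDensity, Fin.prod_univ_castSucc]
    rfl

lemma laggedBlockDensity_succ {Y : Type*} (f : S → S → ℝ) (g : S → Y → ℝ) (μ : ℕ → S → ℝ)
    (y : ℕ → Y) (k : ℕ) :
    ∀ l, laggedBlockDensity f g μ y (l + 1) (k + (l + 1)) (Nat.le_add_left 1 l)
      = pathWeight f (fun i z => g z (y (k + 1 + (i + 1)))) (fun z => μ k z * g z (y (k + 1))) l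
  | 0 => by
    ext x
    simp [laggedBlockDensity, pathWeight]
  | l + 1 => by
    ext x
    rw [pathWeight, ← laggedBlockDensity_succ f g μ y k l]
    unfold laggedBlockDensity
    rw [Fin.prod_univ_castSucc, ← mul_assoc]
    simp only [Nat.add_sub_cancel]
    congr 1

variable [MeasurableSpace S] {ν : Measure S} [IsFiniteMeasure ν] {f : S → S → ℝ}
  {w : ℕ → S → ℝ} {h : S → ℝ}

lemma IsBddMeasurable.pathWeight (hf : IsBddMeasurable (Function.uncurry f))
    (hw : ∀ i, IsBddMeasurable (w i)) (hh : IsBddMeasurable h) :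
    ∀ n, IsBddMeasurable (pathWeight f w h n)
  | 0 => hh.comp (measurable_pi_apply 0)
  | n + 1 =>
    ((IsBddMeasurable.pathWeight hf hw hh n).comp (by fun_prop)).mul
      ((hf.comp (θ := fun x : Fin (n + 2) → S => (x (Fin.last n).castSucc, x (Fin.last (n + 1))))
        (by fun_prop)).mul ((hw n).comp (measurable_pi_apply _)))

lemma integral_pathWeight_zero {ν : Measure S} [SigmaFinite ν] (ψ : S → ℝ) :
    ∫ x, pathWeight f w h 0 x * ψ (x (Fin.last 0)) ∂(Measure.pi fun _ : Fin 1 => ν)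
      = ∫ z, h z * ψ z ∂ν :=
  (measurePreserving_piUnique fun _ : Fin 1 => ν).integral_comp' (fun z => h z * ψ z)

lemma integral_pathWeight_succ (hf : IsBddMeasurable (Function.uncurry f))
    (hw : ∀ i, IsBddMeasurable (w i)) (hh : IsBddMeasurable h) {ψ : S → ℝ}
    (hψ : IsBddMeasurable ψ) (n : ℕ) :
    ∫ x, pathWeight f w h (n + 1) x * ψ (x (Fin.last (n + 1)))
        ∂(Measure.pi fun _ : Fin (n + 2) => ν)
      = ∫ x, pathWeight f w h n x * backwardStep ν f (w n) ψ (x (Fin.last n))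
        ∂(Measure.pi fun _ : Fin (n + 1) => ν) := by
  set F : S × (Fin (n + 1) → S) → ℝ := fun p =>
    pathWeight f w h n p.2 * (f (p.2 (Fin.last n)) p.1 * (w n p.1 * ψ p.1)) with hF
  have hFb : IsBddMeasurable F :=
    ((IsBddMeasurable.pathWeight hf hw hh n).comp measurable_snd).mul
      ((hf.comp (θ := fun p : S × (Fin (n + 1) → S) => (p.2 (Fin.last n), p.1))
        (by fun_prop)).mul (((hw n).mul hψ).comp measurable_fst))
  have h1 := (measurePreserving_piFinSuccAbove (fun _ : Fin (n + 2) => ν)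
    (Fin.last (n + 1))).integral_comp' F
  rw [integral_prod_symm _ (hFb.integrable _)] at h1
  refine Eq.trans ?_ (h1.trans ?_)
  · congr 1
    ext x
    simp only [hF, pathWeight, MeasurableEquiv.piFinSuccAbove_apply, Fin.insertNthEquiv,
      Equiv.coe_fn_symm_mk, Fin.removeNth_last]
    simp only [Fin.init_def]
    ring
  · congr 1
    ext x
    rw [hF, backwardStep, ← integral_const_mul]

lemma integral_pathWeight_add (hf : IsBddMeasurable (Function.uncurry f))
    (hw : ∀ i, IsBddMeasurable (w i)) (hh : IsBddMeasurable h) :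
    ∀ (l s : ℕ) {ψ : S → ℝ}, IsBddMeasurable ψ →
    ∫ x, pathWeight f w h (s + l) x * ψ (x (Fin.last (s + l)))
        ∂(Measure.pi fun _ : Fin (s + l + 1) => ν)
      = ∫ x, pathWeight f w h s x * backward ν f l (fun i => w (s + i)) ψ (x (Fin.last s))
        ∂(Measure.pi fun _ : Fin (s + 1) => ν)
  | 0, _, _, _ => rfl
  | l + 1, s, ψ, hψ => by
    have h1 := integral_pathWeight_add hf hw hh l (s + 1) hψ
    have hb : IsBddMeasurable (backward ν f l (fun i => w (s + 1 + i)) ψ) :=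
      IsBddMeasurable.backward hf l (fun _ => hw _) hψ
    have h2 : ∀ n, n = s + 1 + l →
        ∫ x, pathWeight f w h n x * ψ (x (Fin.last n)) ∂(Measure.pi fun _ : Fin (n + 1) => ν)
          = ∫ x, pathWeight f w h (s + 1 + l) x * ψ (x (Fin.last (s + 1 + l)))
            ∂(Measure.pi fun _ : Fin (s + 1 + l + 1) => ν) := by
      rintro _ rfl
      rfl
    rw [h2 (s + (l + 1)) (by omega), h1, integral_pathWeight_succ hf hw hh hb]
    simp only [backward, add_zero]
    have h3 : (fun i => w (s + 1 + i)) = fun i => w (s + (i + 1)) := by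
      ext i
      rw [add_right_comm, add_assoc]
    rw [h3]

lemma integral_pathWeight_pos [NeZero ν] (hf : IsBddMeasurable (Function.uncurry f))
    (hw : ∀ i, IsBddMeasurable (w i)) (hh : IsBddMeasurable h) (hf0 : ∀ x z, 0 < f x z)
    (hw0 : ∀ i z, 0 < w i z) (hh0 : ∀ x, 0 < h x) (n : ℕ) :
    0 < ∫ x, pathWeight f w h n x ∂(Measure.pi fun _ : Fin (n + 1) => ν) := by
  have : NeZero (Measure.pi fun _ : Fin (n + 1) => ν) := by
    refine ⟨fun h => ?_⟩
    have h1 := congrArg (fun η : Measure (Fin (n + 1) → S) => η Set.univ) h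
    simp [Measure.pi_univ, NeZero.ne ν] at h1
  exact integral_pos_of_pos (IsBddMeasurable.pathWeight hf hw hh n) (pathWeight_pos hf0 hw0 hh0 n)

lemma integral_map_normMeasure_pathWeight [NeZero ν] (hf : IsBddMeasurable (Function.uncurry f))
    (hw : ∀ i, IsBddMeasurable (w i)) (hh : IsBddMeasurable h) (hf0 : ∀ x z, 0 < f x z)
    (hw0 : ∀ i z, 0 < w i z) (hh0 : ∀ x, 0 < h x) (n : ℕ) {ψ : S → ℝ} (hψ : Measurable ψ) :
    ∫ z, ψ z ∂((normMeasure (Measure.pi fun _ : Fin (n + 1) => ν) (pathWeight f w h n)).map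
        fun x => x (Fin.last n))
      = (∫ x, pathWeight f w h n x * ψ (x (Fin.last n)) ∂(Measure.pi fun _ : Fin (n + 1) => ν))
        / ∫ x, pathWeight f w h n x ∂(Measure.pi fun _ : Fin (n + 1) => ν) := by
  rw [integral_map (measurable_pi_apply _).aemeasurable hψ.aestronglyMeasurable,
    integral_normMeasure _ (IsBddMeasurable.pathWeight hf hw hh n)
      (fun x => (pathWeight_pos hf0 hw0 hh0 n x).le)
      (integral_pathWeight_pos hf hw hh hf0 hw0 hh0 n)]

end Paths

/-- Bias bound for the lagged filter of a state-space model whose transition and observation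
densities take values in `[a, b]` with `0 < a`. -/
lemma abs_laggedFilterMarginal_sub_filterMarginal_le {S Y : Type*} [MeasurableSpace S]
    {ν : Measure S} [IsFiniteMeasure ν] [NeZero ν] {f : S → S → ℝ} {g : S → Y → ℝ}
    {μ : ℕ → S → ℝ} {a b ε : ℝ} (ha : 0 < a) (hab : a ≤ b) (hε0 : 0 ≤ ε) (hε : ε * b ≤ a)
    (hε1 : ε ≤ 1) (hf : IsBddMeasurable (Function.uncurry f)) (hfI : ∀ x z, f x z ∈ Set.Icc a b)
    (hg : ∀ yy, IsBddMeasurable fun x => g x yy) (hgI : ∀ x yy, g x yy ∈ Set.Icc a b)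
    (hμ : ∀ k, IsBddMeasurable (μ k)) (hμ0 : ∀ k x, 0 < μ k x) (x0 : S) (y : ℕ → Y) (s l : ℕ)
    {φ : S → ℝ} {M : ℝ} (hφ : Measurable φ) (hφM : ∀ x, |φ x| ≤ M) :
    |(∫ x, φ x ∂(laggedFilterMarginal ν f g μ y (l + 1) (s + 1 + (l + 1)) (Nat.le_add_left 1 l)))
        - ∫ x, φ x ∂(filterMarginal ν f g x0 y (s + (l + 1) + 1) (Nat.le_add_left 1 _))|
      ≤ 2 * (b / a) ^ 2 * ((1 - ε) ^ l * (2 * M)) *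
        (2 * tvDist (normMeasure ν (μ (s + 1)))
          (predictiveMeasure ν f g x0 y (s + 1) (Nat.le_add_left 1 s))) := by
  have hb := ha.trans_le hab
  have hM : 0 ≤ M := (abs_nonneg _).trans (hφM x0)
  have hf0 : ∀ x z, 0 < f x z := fun x z => ha.trans_le (hfI x z).1
  have hg0 : ∀ x yy, 0 < g x yy := fun x yy => ha.trans_le (hgI x yy).1
  have hφb : IsBddMeasurable φ := ⟨hφ, M, hφM⟩
  have h1b : IsBddMeasurable fun _ : S => (1 : ℝ) := IsBddMeasurable.const 1
  set w : ℕ → S → ℝ := fun i z => g z (y (i + 2)) with hw_def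
  have hw : ∀ i, IsBddMeasurable (w i) := fun i => hg _
  have hw0 : ∀ i z, 0 < w i z := fun i z => hg0 _ _
  set w' : ℕ → S → ℝ := fun i => w (s + 1 + i) with hw'_def
  have hw' : ∀ i, IsBddMeasurable (w' i) := fun i => hg _
  have hw'0 : ∀ i z, 0 < w' i z := fun i z => hg0 _ _
  set h : S → ℝ := fun z => f x0 z * g z (y 1)
  have hh : IsBddMeasurable h := (hf.comp (θ := fun z => (x0, z)) (by fun_prop)).mul (hg _)
  have hh0 : ∀ z, 0 < h z := fun z => mul_pos (hf0 _ _) (hg0 _ _)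
  set wk : S → ℝ := w s
  set u := backward ν f l w' (fun _ => 1)
  set v := backward ν f l w' φ
  have hub : IsBddMeasurable u := IsBddMeasurable.backward hf l hw' h1b
  have hvb : IsBddMeasurable v := IsBddMeasurable.backward hf l hw' hφb
  obtain ⟨t, ht, hu⟩ := exists_backward_one_mem_Icc (ν := ν) ha hab hf hfI l hw' hw'0
  obtain ⟨lo, hi, hlh, hlo, hhi⟩ :=
    exists_backward_ratio_bounds (ν := ν) ha hab hε0 hε hf hfI hφ hφM l hw' hw'0
  have hqb : IsBddMeasurable fun x => wk x * u x := (hw s).mul hub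
  have hvqb : IsBddMeasurable fun x => wk x * v x := (hw s).mul hvb
  have hμi : 0 < ∫ x, μ (s + 1) x ∂ν := integral_pos_of_pos (hμ _) (hμ0 _)
  set p₁ : S → ℝ := fun x => μ (s + 1) x / ∫ z, μ (s + 1) z ∂ν with hp₁_def
  have hp₁ : IsBddMeasurable p₁ := by
    simpa only [hp₁_def, div_eq_mul_inv] using (hμ (s + 1)).mul (IsBddMeasurable.const _)
  set F := filterMarginal ν f g x0 y (s + 1) (Nat.le_add_left 1 s) with hF_def
  have hmarg : ∀ n, filterMarginal ν f g x0 y (n + 1) (Nat.le_add_left 1 n)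
      = (normMeasure (Measure.pi fun _ : Fin (n + 1) => ν) (pathWeight f w h n)).map
        fun x => x (Fin.last n) := by
    intro n
    unfold filterMarginal
    rw [smoothDensity_succ]
    rfl
  have hpos : ∀ n, 0 < ∫ x, pathWeight f w h n x ∂(Measure.pi fun _ : Fin (n + 1) => ν) :=
    integral_pathWeight_pos hf hw hh hf0 hw0 hh0
  have hFfin : IsFiniteMeasure F := by
    have := isFiniteMeasure_normMeasure _ (IsBddMeasurable.pathWeight hf hw hh s)
      (fun x => (pathWeight_pos hf0 hw0 hh0 s x).le) (hpos s)
    rw [hF_def, hmarg]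
    infer_instance
  set p₂ : S → ℝ := fun x' => ∫ z, f z x' ∂F with hp₂_def
  have hp₂ : IsBddMeasurable p₂ :=
    (hf.comp (θ := fun p : S × S => (p.2, p.1)) (by fun_prop)).integral_right F
  have hp₂0 : ∀ x, 0 ≤ p₂ x := fun x => integral_nonneg fun z => (hf0 z x).le
  have hswap : ∀ ψ, IsBddMeasurable ψ →
      ∫ x, backwardStep ν f wk ψ x ∂F = ∫ x, p₂ x * (wk x * ψ x) ∂ν := by
    intro ψ hψ
    have hint := (hf.mul (((hw s).mul hψ).comp measurable_snd)).integrable (F.prod ν)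
    unfold backwardStep
    rw [integral_integral_swap hint]
    simp only [integral_mul_const, hp₂_def]
  set Z := ∫ x, pathWeight f w h s x ∂(Measure.pi fun _ : Fin (s + 1) => ν)
  have hI : ∀ ψ, IsBddMeasurable ψ →
      ∫ x, pathWeight f w h (s + (l + 1)) x * ψ (x (Fin.last (s + (l + 1))))
          ∂(Measure.pi fun _ : Fin (s + (l + 1) + 1) => ν)
        = Z * ∫ x, p₂ x * (wk x * backward ν f l w' ψ x) ∂ν := by
    intro ψ hψ
    have hb' : IsBddMeasurable (backward ν f l w' ψ) := IsBddMeasurable.backward hf l hw' hψ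
    rw [integral_pathWeight_add hf hw hh (l + 1) s hψ, ← hswap _ hb', hF_def, hmarg,
      integral_map_normMeasure_pathWeight hf hw hh hf0 hw0 hh0 s
        (IsBddMeasurable.backwardStep hf (hw s) hb').1, mul_div_cancel₀ _ (hpos s).ne']
    have : (fun i => w (s + (i + 1))) = w' := by
      funext i
      simp only [hw'_def]
      rw [add_right_comm s 1 i, add_assoc]
    simp only [backward, this, add_zero]
  have hfilter : ∫ x, φ x ∂(filterMarginal ν f g x0 y (s + (l + 1) + 1) (Nat.le_add_left 1 _))
      = (∫ x, p₂ x * (wk x * v x) ∂ν) / ∫ x, p₂ x * (wk x * u x) ∂ν := by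
    have h1 := hI _ h1b
    simp only [mul_one] at h1
    rw [hmarg, integral_map_normMeasure_pathWeight hf hw hh hf0 hw0 hh0 _ hφ, hI φ hφb, h1,
      mul_div_mul_left _ _ (hpos s).ne']
  have hB₂ : 0 < ∫ x, p₂ x * (wk x * u x) ∂ν := by
    have h1 := hI _ h1b
    simp only [mul_one] at h1
    exact pos_of_mul_pos_right (h1 ▸ hpos (s + (l + 1))) (hpos s).le
  have hlag : ∫ x, φ x
        ∂(laggedFilterMarginal ν f g μ y (l + 1) (s + 1 + (l + 1)) (Nat.le_add_left 1 l))
      = (∫ x, p₁ x * (wk x * v x) ∂ν) / ∫ x, p₁ x * (wk x * u x) ∂ν := by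
    set h' : S → ℝ := fun z => μ (s + 1) z * wk z with hh'_def
    have hh' : IsBddMeasurable h' := (hμ _).mul (hw s)
    have hh'0 : ∀ z, 0 < h' z := fun z => mul_pos (hμ0 _ _) (hw0 _ _)
    have hJ : ∀ ψ, IsBddMeasurable ψ →
        ∫ x, pathWeight f w' h' l x * ψ (x (Fin.last l)) ∂(Measure.pi fun _ : Fin (l + 1) => ν)
          = (∫ z, μ (s + 1) z ∂ν) * ∫ x, p₁ x * (wk x * backward ν f l w' ψ x) ∂ν := by
      intro ψ hψ
      have h2 : ∀ n, n = l →
        ∫ x, pathWeight f w' h' n x * ψ (x (Fin.last n)) ∂(Measure.pi fun _ : Fin (n + 1) => ν)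
          = ∫ x, pathWeight f w' h' l x * ψ (x (Fin.last l))
            ∂(Measure.pi fun _ : Fin (l + 1) => ν) := by
        rintro _ rfl
        rfl
      rw [← h2 (0 + l) (zero_add l), integral_pathWeight_add hf hw' hh' l 0 hψ,
        integral_pathWeight_zero, ← integral_const_mul]
      simp only [zero_add]
      congr 1
      ext z
      rw [hp₁_def, hh'_def]
      field_simp
    have hm : laggedFilterMarginal ν f g μ y (l + 1) (s + 1 + (l + 1)) (Nat.le_add_left 1 l)
        = (normMeasure (Measure.pi fun _ : Fin (l + 1) => ν) (pathWeight f w' h' l)).map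
          fun x => x (Fin.last l) := by
      have : (fun i z => g z (y (s + 1 + 1 + (i + 1)))) = w' := by
        ext i z
        rw [hw'_def, hw_def]
        congr 2
        omega
      unfold laggedFilterMarginal
      rw [laggedBlockDensity_succ, this]
      rfl
    have h1 := hJ _ h1b
    simp only [mul_one] at h1
    rw [hm, integral_map_normMeasure_pathWeight hf hw' hh' hf0 hw'0 hh'0 _ hφ, hJ φ hφb, h1,
      mul_div_mul_left _ _ hμi.ne']
  have hM0 : 0 ≤ (1 - ε) ^ l * (2 * M) :=
    mul_nonneg (pow_nonneg (sub_nonneg.2 hε1) _) (by linarith)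
  have hstab := abs_integral_ratio_sub_le (ν := ν) hp₁ hp₂ hqb hvqb
    (fun x => (div_pos (hμ0 _ x) hμi).le) hp₂0 (by rw [integral_div, div_self hμi.ne'])
    (α := a * (a * t)) (κ := (b / a) ^ 2) (by positivity) (by positivity)
    (sub_nonneg.1 (hlh ▸ hM0))
    (fun x => by
      have e : (b / a) ^ 2 * (a * (a * t)) = b * (b * t) := by
        field_simp
      rw [e]
      exact ⟨mul_le_mul (hgI _ _).1 (hu x).1 (by positivity) (hw0 _ _).le,
        mul_le_mul (hgI _ _).2 (hu x).2 ((by positivity : 0 ≤ a * t).trans (hu x).1) hb.le⟩)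
    (fun x => by
      have := mul_le_mul_of_nonneg_left (hlo x) (hw0 s x).le
      linarith)
    (fun x => by
      have := mul_le_mul_of_nonneg_left (hhi x) (hw0 s x).le
      linarith) hB₂
  have htv := integral_abs_sub_le_two_mul_tvDist ν hp₁ hp₂
    (fun x => (div_pos (hμ0 _ x) hμi).le) hp₂0
  rw [← normMeasure_eq_withDensity ν (hμ _) (fun x => (hμ0 _ x).le) hμi] at htv
  rw [hlag, hfilter]
  rw [hlh] at hstab
  exact hstab.trans (mul_le_mul_of_nonneg_left htv (mul_nonneg (by positivity) hM0))

/-- Proposition 3.2(i): exponential-in-`L` bias bound for the `m`-block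
lagged filter. If `g̃, ḡ, f̃, f̄` take values in `[c,C]` and `|μ̃_k| ≤ C`, `|μ̄_k| ≤ C`, then
there exist `ρ ∈ (0,1)` and `C' < ∞`, depending only on `c`, `C`, `m` and `E`, such that for
all `n ≥ L+1` and all bounded measurable `φ^{(m)}`,
`|π̃^{(m)}_{1,n,n}(φ^{(m)}) − π^{(m)}_{(n)}(φ^{(m)})|
  ≤ C' ‖φ^{(m)}‖_∞ ‖μ̄^{(m)}_{n-L} − π^{(m)}_{(n-L+1|n-L)}‖_TV ρ^L`. -/
theorem lagged_filter_bias_bound_block :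
    ∀ (E : Set ℝ), IsCompact E → 0 < MeasureTheory.volume E →
    ∀ (m : ℕ) (c C : ℝ), 0 < c → c ≤ C →
    ∃ ρ : ℝ, ρ ∈ Set.Ioo (0:ℝ) 1 ∧
    ∃ C' : ℝ, 0 ≤ C' ∧
      ∀ (Y : Type) (_ : MeasurableSpace Y) (x0 : Fin m → ↥E) (y : ℕ → Y)
        (gt : (Fin m → ↥E) → Y → ℝ) (gbar : ↥E → Y → ℝ)
        (ft : (Fin m → ↥E) → (Fin m → ↥E) → ℝ) (fbar : ↥E → ↥E → ℝ)
        (μt : ℕ → (Fin m → ↥E) → ℝ) (μbar : ℕ → ↥E → ℝ),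
        Measurable (Function.uncurry gt) → Measurable (Function.uncurry gbar) →
        Measurable (Function.uncurry ft) → Measurable (Function.uncurry fbar) →
        (∀ k, Measurable (μt k)) → (∀ k, Measurable (μbar k)) →
        (∀ x yy, gt x yy ∈ Set.Icc c C) → (∀ a b, gbar a b ∈ Set.Icc c C) →
        (∀ x z, ft x z ∈ Set.Icc c C) → (∀ a b, fbar a b ∈ Set.Icc c C) →
        (∀ k x, |μt k x| ≤ C) → (∀ k a, |μbar k a| ≤ C) →
      ∀ (L n : ℕ) (hL : 1 ≤ L) (hn : L + 1 ≤ n),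
      ∀ (φ : (Fin m → ↥E) → ℝ) (Mφ : ℝ), Measurable φ → (∀ x, |φ x| ≤ Mφ) →
        |(∫ x, φ x ∂(laggedFilterMarginal (Measure.pi fun _ : Fin m => subMeasure E)
              (fBlock ft fbar) (gBlock gt gbar) (μBlock μt μbar) y L n hL)) -
          ∫ x, φ x ∂(filterMarginal (Measure.pi fun _ : Fin m => subMeasure E)
              (fBlock ft fbar) (gBlock gt gbar) x0 y n (by omega))| ≤
        C' * Mφ *
          tvDist
            (normMeasure (Measure.pi fun _ : Fin m => subMeasure E) (μBlock μt μbar (n - L)))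
            (predictiveMeasure (Measure.pi fun _ : Fin m => subMeasure E)
              (fBlock ft fbar) (gBlock gt gbar) x0 y (n - L) (by omega)) *
          ρ ^ L := by
  intro E hE hEpos m c C hc hcC
  set a := Real.exp (c + m * c)
  set b := Real.exp (C + m * C)
  have ha : 0 < a := Real.exp_pos _
  have hb : 0 < b := Real.exp_pos _
  have hab : a ≤ b := Real.exp_le_exp.2 (by gcongr)
  set ε := a / b / 2 with hε_def
  have hε0 : 0 < ε := by positivity
  have hε1 : ε < 1 := by
    have := (div_le_one hb).2 hab
    linarith
  have hεb : ε * b ≤ a := by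
    have : ε * b = a / 2 := by
      rw [hε_def]
      field_simp
    linarith
  have hsum : ∀ r : Fin m → ℝ, (∀ j, r j ∈ Set.Icc c C) → ∑ j, r j ∈ Set.Icc (m * c) (m * C) := by
    intro r hr
    have h1 := Finset.card_nsmul_le_sum Finset.univ r c fun j _ => (hr j).1
    have h2 := Finset.sum_le_card_nsmul Finset.univ r C fun j _ => (hr j).2
    simp only [Finset.card_univ, Fintype.card_fin, nsmul_eq_mul] at h1 h2
    exact ⟨h1, h2⟩
  have hemb : MeasurableEmbedding (Subtype.val : ↥E → ℝ) :=
    MeasurableEmbedding.subtype_coe hE.measurableSet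
  have huniv : subMeasure E Set.univ = volume E := by
    rw [subMeasure, hemb.comap_apply, Set.image_univ, Subtype.range_coe]
  have hfin : IsFiniteMeasure (subMeasure E) := ⟨huniv ▸ hE.measure_lt_top⟩
  have hne : NeZero (Measure.pi fun _ : Fin m => subMeasure E) := by
    refine ⟨fun h => ?_⟩
    have h1 := congrArg (fun η : Measure (Fin m → ↥E) => η Set.univ) h
    simp only [Measure.pi_univ, huniv, Measure.coe_zero, Pi.zero_apply] at h1
    exact Finset.prod_ne_zero_iff.2 (fun _ _ => hEpos.ne') h1
  refine ⟨1 - ε, ⟨by linarith, by linarith⟩, 8 * (b / a) ^ 2 / (1 - ε),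
    div_nonneg (by positivity) (by linarith), ?_⟩
  intro Y _ x0 y gt gbar ft fbar μt μbar hgt hgbar hft hfbar hμt hμbar hgtI hgbarI hftI hfbarI
    hμtI hμbarI L n hL hn φ M hφ hφM
  have hfI : ∀ x z, fBlock ft fbar x z ∈ Set.Icc a b := fun x z =>
    have h := hsum (fun j => fbar (x j) (z j)) fun j => hfbarI _ _
    ⟨Real.exp_le_exp.2 (add_le_add (hftI x z).1 h.1),
      Real.exp_le_exp.2 (add_le_add (hftI x z).2 h.2)⟩
  have hgI : ∀ x yy, gBlock gt gbar x yy ∈ Set.Icc a b := fun x yy =>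
    have h := hsum (fun j => gbar (x j) yy) fun j => hgbarI _ _
    ⟨Real.exp_le_exp.2 (add_le_add (hgtI x yy).1 h.1),
      Real.exp_le_exp.2 (add_le_add (hgtI x yy).2 h.2)⟩
  have hμI : ∀ k x, μBlock μt μbar k x ∈ Set.Icc 0 b := fun k x => by
    have h := Finset.sum_le_card_nsmul Finset.univ (fun j => μbar k (x j)) C
      fun j _ => (abs_le.1 (hμbarI k (x j))).2
    simp only [Finset.card_univ, Fintype.card_fin, nsmul_eq_mul] at h
    exact ⟨(Real.exp_pos _).le, Real.exp_le_exp.2 (add_le_add (abs_le.1 (hμtI k x)).2 h)⟩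
  have hfm : Measurable (Function.uncurry (fBlock ft fbar)) := by
    refine Real.measurable_exp.comp (hft.add (Finset.measurable_sum _ fun j _ => ?_))
    exact hfbar.comp (f := fun p : (Fin m → ↥E) × (Fin m → ↥E) => (p.1 j, p.2 j)) (by fun_prop)
  have hgm : ∀ yy, Measurable fun x => gBlock gt gbar x yy := by
    intro yy
    refine Real.measurable_exp.comp
      ((hgt.comp (f := fun x => (x, yy)) (by fun_prop)).add (Finset.measurable_sum _ fun j _ => ?_))
    exact hgbar.comp (f := fun x : Fin m → ↥E => (x j, yy)) (by fun_prop)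
  have hμm : ∀ k, Measurable (μBlock μt μbar k) := fun k =>
    Real.measurable_exp.comp ((hμt k).add
      (Finset.measurable_sum _ fun j _ => (hμbar k).comp (measurable_pi_apply j)))
  obtain ⟨l, rfl⟩ : ∃ l, L = l + 1 := ⟨L - 1, by omega⟩
  obtain ⟨s, rfl⟩ : ∃ s, n = s + 1 + (l + 1) := ⟨n - l - 2, by omega⟩
  have main := abs_laggedFilterMarginal_sub_filterMarginal_le
    (ν := Measure.pi fun _ : Fin m => subMeasure E) ha hab hε0.le hεb hε1.le
    (IsBddMeasurable.of_mem_Icc hfm fun p => hfI p.1 p.2) hfI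
    (fun yy => IsBddMeasurable.of_mem_Icc (hgm yy) fun x => hgI x yy) hgI
    (fun k => IsBddMeasurable.of_mem_Icc (hμm k) (hμI k)) (fun _ _ => Real.exp_pos _)
    x0 y s l hφ hφM
  have hidx : s + 1 + (l + 1) - (l + 1) = s + 1 := Nat.add_sub_cancel _ _
  have hidx' : s + (l + 1) + 1 = s + 1 + (l + 1) := by omega
  simp only [hidx, hidx'] at main ⊢
  refine main.trans (le_of_eq ?_)
  have h1 : 1 - ε ≠ 0 := by linarith
  rw [pow_succ]
  field_simp
  ring
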